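/- For a field F, let C(n) denote the number of orbits of alternating n×n matrices over F under B-congruence. Then this number is finite for all n and satisfies C(0) = 1, C(1) = 1, and C(n) = C(n-1) + (n-1)·C(n-2) for all n ≥ 2. -/

import Mathlib

open Matrix

/-- Membership in `B`: invertible upper triangular matrices. -/
def InB {F : Type*} [Field F] {n : ℕ} (h : Matrix (Fin n) (Fin n) F) : Prop :=
  IsUnit h.det ∧ ∀ i j : Fin n, j < i → h i j = 0

/-- An alternating matrix: `Xᵀ = -X` and all diagonal entries are 0. -/
def IsAlternating {F : Type*} [Field F] {n : ℕ} (X : Matrix (Fin n) (Fin n) F) :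
    Prop :=
  Xᵀ = -X ∧ ∀ i, X i i = 0

/-- `B`-congruence on alternating `n × n` matrices over `F`. -/
def AltBCong (F : Type*) [Field F] (n : ℕ)
    (X Y : {A : Matrix (Fin n) (Fin n) F // IsAlternating A}) : Prop :=
  ∃ h : Matrix (Fin n) (Fin n) F, InB h ∧ Y.1 = hᵀ * X.1 * h

section Congruence

variable {F : Type*} [Field F] {n : ℕ}

theorem inB_iff {h : Matrix (Fin n) (Fin n) F} :
    InB h ↔ (∀ i, h i i ≠ 0) ∧ ∀ i j : Fin n, j < i → h i j = 0 := by
  refine and_congr_left fun ht => ?_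
  have hb : h.BlockTriangular id := fun i j hij => ht i j hij
  rw [det_of_isUpperTriangular hb, isUnit_iff_ne_zero, Finset.prod_ne_zero_iff]
  simp

theorem altBCong_equivalence : Equivalence (AltBCong F n) where
  refl X := ⟨1, inB_iff.2 ⟨by simp, fun i j hij => one_apply_ne hij.ne'⟩, by simp⟩
  symm := by
    rintro X Y ⟨h, ⟨hu, ht⟩, hY⟩
    have hb : h.BlockTriangular id := fun i j hij => ht i j hij
    have := invertibleOfIsUnitDet h hu
    refine ⟨h⁻¹, ⟨isUnit_nonsing_inv_det h hu, fun i j hij =>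
      blockTriangular_inv_of_blockTriangular hb hij⟩, ?_⟩
    have h1 : h⁻¹ᵀ * hᵀ = 1 := by rw [← transpose_mul, mul_nonsing_inv h hu, transpose_one]
    rw [hY, Matrix.mul_assoc, Matrix.mul_assoc, mul_nonsing_inv h hu, Matrix.mul_one,
      ← Matrix.mul_assoc, h1, Matrix.one_mul]
  trans := by
    rintro X Y Z ⟨h, ⟨hu, ht⟩, hY⟩ ⟨k, ⟨ku, kt⟩, hZ⟩
    have hb : h.BlockTriangular id := fun i j hij => ht i j hij
    have kb : k.BlockTriangular id := fun i j hij => kt i j hij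
    refine ⟨h * k, ⟨by rw [det_mul]; exact hu.mul ku, fun i j hij => hb.mul kb hij⟩, ?_⟩
    rw [hZ, hY, transpose_mul]
    simp only [Matrix.mul_assoc]

theorem quot_mk_eq_iff {X Y : {A : Matrix (Fin n) (Fin n) F // IsAlternating A}} :
    Quot.mk (AltBCong F n) X = Quot.mk _ Y ↔ AltBCong F n X Y :=
  altBCong_equivalence.quot_mk_eq_iff X Y

theorem IsAlternating.apply_swap {X : Matrix (Fin n) (Fin n) F} (hX : IsAlternating X)
    (i j : Fin n) : X j i = -X i j :=
  congrFun (congrFun hX.1 i) j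

theorem isAlternating_iff {X : Matrix (Fin n) (Fin n) F} :
    IsAlternating X ↔ (∀ i j, X j i = -X i j) ∧ ∀ i, X i i = 0 :=
  ⟨fun h => ⟨h.apply_swap, h.2⟩, fun h => ⟨by ext i j; exact h.1 i j, h.2⟩⟩

theorem IsAlternating.submatrix {m : ℕ} {X : Matrix (Fin n) (Fin n) F} (hX : IsAlternating X)
    (f : Fin m → Fin n) : IsAlternating (X.submatrix f f) :=
  isAlternating_iff.2 ⟨fun _ _ => hX.apply_swap _ _, fun _ => hX.2 _⟩

theorem IsAlternating.congr {X : Matrix (Fin n) (Fin n) F} (hX : IsAlternating X)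
    (h : Matrix (Fin n) (Fin n) F) : IsAlternating (hᵀ * X * h) := by
  refine ⟨by simp [hX.1, Matrix.mul_assoc], fun i => ?_⟩
  have key : (hᵀ * X * h) i i = ∑ p : Fin n × Fin n, h p.1 i * X p.1 p.2 * h p.2 i := by
    rw [Fintype.sum_prod_type_right]
    simp only [mul_apply, transpose_apply, Finset.sum_mul]
  rw [key]
  refine Finset.sum_involution (fun p _ => p.swap) ?_ ?_ (by simp) (by simp)
  · rintro ⟨a, b⟩ -
    simp only [Prod.swap, hX.apply_swap a b]
    ring
  · rintro ⟨a, b⟩ - hne heq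
    obtain rfl : b = a := congrArg Prod.fst heq
    exact hne (by simp [hX.2])

theorem InB.submatrix {m : ℕ} {h : Matrix (Fin n) (Fin n) F} (hh : InB h)
    {f : Fin m → Fin n} (hf : StrictMono f) : InB (h.submatrix f f) := by
  rw [inB_iff] at hh ⊢
  exact ⟨fun i => hh.1 _, fun i j hij => hh.2 _ _ (hf hij)⟩

/-- A row of a congruent matrix, when the corresponding column of the transition matrix is a
multiple of a standard basis vector. -/
theorem congr_apply_of_column {h : Matrix (Fin n) (Fin n) F} (X : Matrix (Fin n) (Fin n) F)
    {p : Fin n} (hp : ∀ i, i ≠ p → h i p = 0) (b : Fin n) :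
    (hᵀ * X * h) p b = h p p * ∑ a, X p a * h a b := by
  have hs (a) : ∑ i, h i p * X i a = h p p * X p a :=
    Fintype.sum_eq_single p fun i hi => by rw [hp i hi, zero_mul]
  simp only [mul_apply, transpose_apply, hs, Finset.mul_sum, mul_assoc]

theorem InB.congr_apply_zero {h : Matrix (Fin (n + 1)) (Fin (n + 1)) F} (hh : InB h)
    (X : Matrix (Fin (n + 1)) (Fin (n + 1)) F) (b : Fin (n + 1)) :
    (hᵀ * X * h) 0 b = h 0 0 * ∑ a, X 0 a * h a b :=
  congr_apply_of_column X (fun _ hi => hh.2 _ _ (Fin.pos_iff_ne_zero.2 hi)) b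

end Congruence

section Blocks

variable {F : Type*} [Field F] {n : ℕ}

/-- Insert a row and a column at position `p`, equal to zero except for the entry `c` on the
diagonal. -/
def insertDiag (p : Fin (n + 1)) (c : F) (A : Matrix (Fin n) (Fin n) F) :
    Matrix (Fin (n + 1)) (Fin (n + 1)) F :=
  of (p.insertNth (α := fun _ => Fin (n + 1) → F) (p.insertNth (α := fun _ => F) c 0)
    fun a => p.insertNth (α := fun _ => F) 0 (A a))

/-- The orthogonal sum of `X` with the standard hyperbolic plane on the basis vectors `0` and
`j.succ`. -/
def insertPlane (j : Fin (n + 1)) (X : Matrix (Fin n) (Fin n) F) :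
    Matrix (Fin (n + 2)) (Fin (n + 2)) F :=
  insertDiag 0 0 (insertDiag j 0 X) + single 0 j.succ 1 - single j.succ 0 1

@[simp] theorem insertDiag_self (p : Fin (n + 1)) (c : F) (A : Matrix (Fin n) (Fin n) F) :
    insertDiag p c A p p = c := by simp [insertDiag]

@[simp] theorem insertDiag_self_succAbove (p : Fin (n + 1)) (c : F)
    (A : Matrix (Fin n) (Fin n) F) (k : Fin n) : insertDiag p c A p (p.succAbove k) = 0 := by
  simp [insertDiag]

@[simp] theorem insertDiag_succAbove_self (p : Fin (n + 1)) (c : F)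
    (A : Matrix (Fin n) (Fin n) F) (k : Fin n) : insertDiag p c A (p.succAbove k) p = 0 := by
  simp [insertDiag]

@[simp] theorem insertDiag_succAbove_succAbove (p : Fin (n + 1)) (c : F)
    (A : Matrix (Fin n) (Fin n) F) (k l : Fin n) :
    insertDiag p c A (p.succAbove k) (p.succAbove l) = A k l := by
  simp [insertDiag]

@[simp] theorem insertDiag_zero_succ (c : F) (A : Matrix (Fin n) (Fin n) F) (k : Fin n) :
    insertDiag 0 c A 0 k.succ = 0 := insertDiag_self_succAbove 0 c A k

@[simp] theorem insertDiag_succ_zero (c : F) (A : Matrix (Fin n) (Fin n) F) (k : Fin n) :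
    insertDiag 0 c A k.succ 0 = 0 := insertDiag_succAbove_self 0 c A k

@[simp] theorem insertDiag_succ_succ (c : F) (A : Matrix (Fin n) (Fin n) F) (k l : Fin n) :
    insertDiag 0 c A k.succ l.succ = A k l := insertDiag_succAbove_succAbove 0 c A k l

theorem insertDiag_isAlternating (p : Fin (n + 1)) {X : Matrix (Fin n) (Fin n) F}
    (hX : IsAlternating X) : IsAlternating (insertDiag p 0 X) := by
  refine isAlternating_iff.2 ⟨fun i j => ?_, fun i => ?_⟩
  · cases i using p.succAboveCases <;> cases j using p.succAboveCases <;>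
      simp [← hX.apply_swap]
  · cases i using p.succAboveCases <;> simp [hX.2]

theorem insertPlane_isAlternating (j : Fin (n + 1)) {X : Matrix (Fin n) (Fin n) F}
    (hX : IsAlternating X) : IsAlternating (insertPlane j X) := by
  have h := insertDiag_isAlternating 0 (insertDiag_isAlternating j hX)
  refine ⟨?_, fun i => ?_⟩
  · simp only [insertPlane, transpose_sub, transpose_add, transpose_single, h.1]
    abel
  · simp only [insertPlane, Matrix.sub_apply, Matrix.add_apply, h.2]
    cases i using Fin.cases <;> simp [(Fin.succ_ne_zero _).symm]

theorem insertDiag_inB (p : Fin (n + 1)) {h : Matrix (Fin n) (Fin n) F} (hh : InB h) :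
    InB (insertDiag p 1 h) := by
  rw [inB_iff] at hh ⊢
  refine ⟨fun i => ?_, fun i j hij => ?_⟩
  · cases i using p.succAboveCases <;> simp [hh.1]
  · cases i using p.succAboveCases <;> cases j using p.succAboveCases
    · exact absurd hij (lt_irrefl _)
    · simp
    · simp
    · simpa using hh.2 _ _ (by simpa using hij)

theorem insertDiag_transpose (p : Fin (n + 1)) (c : F) (A : Matrix (Fin n) (Fin n) F) :
    (insertDiag p c A)ᵀ = insertDiag p c Aᵀ := by
  ext i j
  cases i using p.succAboveCases <;> cases j using p.succAboveCases <;> simp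

theorem insertDiag_mul (p : Fin (n + 1)) (c d : F) (A B : Matrix (Fin n) (Fin n) F) :
    insertDiag p c A * insertDiag p d B = insertDiag p (c * d) (A * B) := by
  ext i j
  cases i using p.succAboveCases <;> cases j using p.succAboveCases <;>
    simp [mul_apply, Fin.sum_univ_succAbove _ p]

theorem insertDiag_congr (p : Fin (n + 1)) (X h : Matrix (Fin n) (Fin n) F) :
    (insertDiag p 1 h)ᵀ * insertDiag p 0 X * insertDiag p 1 h = insertDiag p 0 (hᵀ * X * h) := by
  simp [insertDiag_transpose, insertDiag_mul]

@[simp] theorem insertPlane_zero_zero (j : Fin (n + 1)) (X : Matrix (Fin n) (Fin n) F) :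
    insertPlane j X 0 0 = 0 := by
  simp [insertPlane]

@[simp] theorem insertPlane_zero_succ (j k : Fin (n + 1)) (X : Matrix (Fin n) (Fin n) F) :
    insertPlane j X 0 k.succ = if j = k then 1 else 0 := by
  simp [insertPlane, single_apply]

@[simp] theorem insertPlane_succ_zero (j k : Fin (n + 1)) (X : Matrix (Fin n) (Fin n) F) :
    insertPlane j X k.succ 0 = if j = k then -1 else 0 := by
  simp [insertPlane, single_apply]
  split_ifs <;> simp

@[simp] theorem insertPlane_succ_succ (j k l : Fin (n + 1)) (X : Matrix (Fin n) (Fin n) F) :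
    insertPlane j X k.succ l.succ = insertDiag j 0 X k l := by
  simp [insertPlane, (Fin.succ_ne_zero _).symm]

theorem insertPlane_congr (j : Fin (n + 1)) (X h : Matrix (Fin n) (Fin n) F) :
    (insertDiag 0 1 (insertDiag j 1 h))ᵀ * insertPlane j X * insertDiag 0 1 (insertDiag j 1 h) =
      insertPlane j (hᵀ * X * h) := by
  ext a b
  cases a using Fin.cases with
  | zero =>
    cases b using Fin.cases with
    | zero => simp [mul_apply, Fin.sum_univ_succ]
    | succ b =>
      cases b using j.succAboveCases <;>
        simp [mul_apply, Fin.sum_univ_succ, Fin.sum_univ_succAbove _ j]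
  | succ a =>
    cases b using Fin.cases with
    | zero =>
      cases a using j.succAboveCases <;>
        simp [mul_apply, Fin.sum_univ_succ, Fin.sum_univ_succAbove _ j]
    | succ b =>
      cases a using j.succAboveCases <;> cases b using j.succAboveCases <;>
        simp [mul_apply, Fin.sum_univ_succ, Fin.sum_univ_succAbove _ j]

theorem eq_insertDiag {X : Matrix (Fin (n + 1)) (Fin (n + 1)) F} (hX : IsAlternating X)
    (h0 : ∀ k : Fin n, X 0 k.succ = 0) :
    X = insertDiag 0 0 (X.submatrix Fin.succ Fin.succ) := by
  ext a b
  cases a using Fin.cases <;> cases b using Fin.cases <;> simp [hX.2, h0, hX.apply_swap 0]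

theorem eq_insertPlane {X : Matrix (Fin (n + 2)) (Fin (n + 2)) F} (hX : IsAlternating X)
    (j : Fin (n + 1)) (h0 : X 0 j.succ = 1) (h1 : ∀ k : Fin n, X 0 (j.succAbove k).succ = 0)
    (h2 : ∀ k : Fin n, X j.succ (j.succAbove k).succ = 0) :
    X = insertPlane j
      (X.submatrix (fun k => (j.succAbove k).succ) fun k => (j.succAbove k).succ) := by
  have h0' : X j.succ 0 = -1 := by rw [hX.apply_swap 0, h0]
  have h1' (k) : X (j.succAbove k).succ 0 = 0 := by rw [hX.apply_swap 0, h1, neg_zero]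
  have h2' (k) : X (j.succAbove k).succ j.succ = 0 := by rw [hX.apply_swap j.succ, h2, neg_zero]
  ext a b
  cases a using Fin.cases with
  | zero =>
    cases b using Fin.cases with
    | zero => simp [hX.2]
    | succ b => cases b using j.succAboveCases <;> simp [h0, h1, (Fin.succAbove_ne _ _).symm]
  | succ a =>
    cases b using Fin.cases with
    | zero => cases a using j.succAboveCases <;> simp [h0', h1', (Fin.succAbove_ne _ _).symm]
    | succ b =>
      cases a using j.succAboveCases <;> cases b using j.succAboveCases <;> simp [h2, h2', hX.2]

end Blocks

section Orbits

variable {F : Type*} [Field F] {n : ℕ}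

theorem exists_congr_eq_insertPlane {X : Matrix (Fin (n + 2)) (Fin (n + 2)) F}
    (hX : IsAlternating X) {j : Fin (n + 1)} (hj : X 0 j.succ ≠ 0)
    (hlt : ∀ k < j, X 0 k.succ = 0) :
    ∃ X' : Matrix (Fin n) (Fin n) F, IsAlternating X' ∧
      ∃ h, InB h ∧ hᵀ * X * h = insertPlane j X' := by
  obtain ⟨d, hd0, hdj, hd⟩ : ∃ d : Fin (n + 2) → F, d 0 = 1 ∧ d j.succ = (X 0 j.succ)⁻¹ ∧
      ∀ k : Fin n, d (j.succAbove k).succ = 1 :=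
    ⟨fun b => if b = j.succ then (X 0 j.succ)⁻¹ else 1,
      by simp [(Fin.succ_ne_zero _).symm], by simp, by simp [Fin.succAbove_ne]⟩
  obtain ⟨α, hα0, hαj, hα⟩ : ∃ α : Fin (n + 2) → F, α 0 = 0 ∧ α j.succ = 0 ∧
      ∀ k : Fin n, α (j.succAbove k).succ = X j.succ (j.succAbove k).succ / X 0 j.succ :=
    ⟨fun b => if b = 0 then 0 else X j.succ b / X 0 j.succ, by simp, by simp [hX.2], by simp⟩
  obtain ⟨β, hβ0, hβj, hβ⟩ : ∃ β : Fin (n + 2) → F, β 0 = 0 ∧ β j.succ = 0 ∧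
      ∀ k : Fin n, β (j.succAbove k).succ = -X 0 (j.succAbove k).succ / X 0 j.succ :=
    ⟨fun b => if b = j.succ then 0 else -X 0 b / X 0 j.succ, by simp [hX.2], by simp,
      by simp [Fin.succAbove_ne]⟩
  set h : Matrix (Fin (n + 2)) (Fin (n + 2)) F := of fun a b =>
    (if a = b then d b else 0) + (if a = 0 then α b else 0) + (if a = j.succ then β b else 0)
    with h_def
  have hdiag : ∀ i, h i i = d i := by
    intro i
    simp only [h_def, of_apply, if_true]
    split_ifs <;> simp_all
  have hd_ne : ∀ i, d i ≠ 0 := by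
    intro i
    cases i using Fin.cases with
    | zero => simp [hd0]
    | succ i => cases i using j.succAboveCases <;> simp [hdj, hd, hj]
  have hβlt : ∀ b < j.succ, β b = 0 := by
    intro b hb
    cases b using Fin.cases with
    | zero => exact hβ0
    | succ b => cases b using j.succAboveCases <;> simp_all
  have hB : InB h := by
    refine inB_iff.2 ⟨fun i => hdiag i ▸ hd_ne i, fun i b hb => ?_⟩
    have hi0 : i ≠ 0 := (Fin.pos_iff_ne_zero.1 (lt_of_le_of_lt (Fin.zero_le b) hb))
    simp only [h_def, of_apply, if_neg hb.ne', if_neg hi0, zero_add]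
    split_ifs with hij
    · exact hβlt b (hij ▸ hb)
    · rfl
  have hcol : ∀ i, i ≠ j.succ → h i j.succ = 0 := by
    intro i hi
    simp [h_def, hi, hαj]
  have hrow (p b) : ∑ a, X p a * h a b = X p b * d b + X p 0 * α b + X p j.succ * β b := by
    simp [h_def, mul_add, Finset.sum_add_distrib]
  refine ⟨_, (hX.congr h).submatrix _, h, hB, eq_insertPlane (hX.congr h) j ?_ ?_ ?_⟩
  · rw [hB.congr_apply_zero, hrow, hdiag, hd0, hdj, hαj, hβj]
    field_simp
    ring
  · intro k
    rw [hB.congr_apply_zero, hrow, hX.2, hβ, hd]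
    field_simp
    ring
  · intro k
    rw [congr_apply_of_column X hcol, hrow, hX.2, hα, hd, hX.apply_swap 0]
    field_simp
    ring

theorem insertDiag_not_congr_insertPlane {X : Matrix (Fin (n + 1)) (Fin (n + 1)) F}
    {j : Fin (n + 1)} {Y : Matrix (Fin n) (Fin n) F} {h : Matrix (Fin (n + 2)) (Fin (n + 2)) F}
    (hh : InB h) : insertPlane j Y ≠ hᵀ * insertDiag 0 0 X * h := by
  intro heq
  have := congrFun (congrFun heq 0) j.succ
  rw [hh.congr_apply_zero] at this
  simp [Fin.sum_univ_succ] at this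

theorem insertDiag_congr_insertDiag {X Y : Matrix (Fin n) (Fin n) F}
    {h : Matrix (Fin (n + 1)) (Fin (n + 1)) F}
    (heq : insertDiag 0 0 Y = hᵀ * insertDiag 0 0 X * h) :
    Y = (h.submatrix Fin.succ Fin.succ)ᵀ * X * h.submatrix Fin.succ Fin.succ := by
  ext a b
  have := congrFun (congrFun heq a.succ) b.succ
  simpa [mul_apply, Fin.sum_univ_succ] using this

theorem le_of_insertPlane_congr {i j : Fin (n + 1)} {X Y : Matrix (Fin n) (Fin n) F}
    {h : Matrix (Fin (n + 2)) (Fin (n + 2)) F} (hh : InB h)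
    (heq : insertPlane j Y = hᵀ * insertPlane i X * h) : i ≤ j := by
  by_contra! hlt
  have := congrFun (congrFun heq 0) j.succ
  rw [hh.congr_apply_zero] at this
  simp [Fin.sum_univ_succ, hh.2 _ _ (Fin.succ_lt_succ_iff.2 hlt)] at this

theorem insertPlane_congr_insertPlane {j : Fin (n + 1)} {X Y : Matrix (Fin n) (Fin n) F}
    {h : Matrix (Fin (n + 2)) (Fin (n + 2)) F} (hh : InB h)
    (heq : insertPlane j Y = hᵀ * insertPlane j X * h) :
    Y = (h.submatrix (fun k => (j.succAbove k).succ) fun k => (j.succAbove k).succ)ᵀ * X *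
      h.submatrix (fun k => (j.succAbove k).succ) fun k => (j.succAbove k).succ := by
  have hj (b : Fin n) : h j.succ (j.succAbove b).succ = 0 := by
    have := congrFun (congrFun heq 0) (j.succAbove b).succ
    rw [hh.congr_apply_zero] at this
    simpa [Fin.sum_univ_succ, (inB_iff.1 hh).1, (Fin.succAbove_ne _ _).symm] using this
  ext a b
  have := congrFun (congrFun heq (j.succAbove a).succ) (j.succAbove b).succ
  simpa [mul_apply, Fin.sum_univ_succ, Fin.sum_univ_succAbove _ j, hj] using this

variable (F n) in
/-- Every orbit in size `n + 2` comes either from an orbit in size `n + 1`, when the first basis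
vector lies in the radical, or from the position of the first basis vector not orthogonal to it
together with an orbit in size `n`. -/
def orbitMap : Quot (AltBCong F (n + 1)) ⊕ Fin (n + 1) × Quot (AltBCong F n) →
    Quot (AltBCong F (n + 2)) :=
  Sum.elim
    (Quot.map (fun X => ⟨insertDiag 0 0 X.1, insertDiag_isAlternating 0 X.2⟩) fun X Y ⟨h, hh, hY⟩ =>
      ⟨insertDiag 0 1 h, insertDiag_inB 0 hh, by simp only [hY, insertDiag_congr]⟩)
    fun p => Quot.map (fun X => ⟨insertPlane p.1 X.1, insertPlane_isAlternating p.1 X.2⟩)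
      (fun X Y ⟨h, hh, hY⟩ => ⟨insertDiag 0 1 (insertDiag p.1 1 h),
        insertDiag_inB 0 (insertDiag_inB p.1 hh), by simp only [hY, insertPlane_congr]⟩) p.2

theorem orbitMap_injective : Function.Injective (orbitMap F n) := by
  rintro (⟨⟨X⟩⟩ | ⟨i, ⟨X⟩⟩) (⟨⟨Y⟩⟩ | ⟨j, ⟨Y⟩⟩) heq
  · obtain ⟨h, hh, hY⟩ := quot_mk_eq_iff.1 heq
    exact congrArg Sum.inl (Quot.sound
      ⟨_, hh.submatrix Fin.strictMono_succ, insertDiag_congr_insertDiag hY⟩)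
  · obtain ⟨h, hh, hY⟩ := quot_mk_eq_iff.1 heq
    exact absurd hY (insertDiag_not_congr_insertPlane hh)
  · obtain ⟨h, hh, hY⟩ := quot_mk_eq_iff.1 heq.symm
    exact absurd hY (insertDiag_not_congr_insertPlane hh)
  · obtain ⟨h, hh, hY⟩ := quot_mk_eq_iff.1 heq
    obtain ⟨k, hk, hX⟩ := quot_mk_eq_iff.1 heq.symm
    obtain rfl := le_antisymm (le_of_insertPlane_congr hh hY) (le_of_insertPlane_congr hk hX)
    exact congrArg (fun q => Sum.inr (i, q)) (Quot.sound
      ⟨_, hh.submatrix (Fin.strictMono_succ.comp (Fin.strictMono_succAbove i)),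
        insertPlane_congr_insertPlane hh hY⟩)

theorem orbitMap_surjective : Function.Surjective (orbitMap F n) := by
  classical
  rintro ⟨X, hX⟩
  by_cases h0 : ∀ k : Fin (n + 1), X 0 k.succ = 0
  · exact ⟨Sum.inl (Quot.mk _ ⟨_, hX.submatrix Fin.succ⟩),
      congrArg (Quot.mk _) (Subtype.ext (eq_insertDiag hX h0).symm)⟩
  · push Not at h0
    obtain ⟨j, hj, hmin⟩ := WellFounded.has_min (wellFounded_lt (α := Fin (n + 1)))
      {k | X 0 k.succ ≠ 0} h0
    obtain ⟨X', hX', h, hh, heq⟩ := exists_congr_eq_insertPlane hX hj fun k hk => by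
      by_contra hne
      exact hmin k hne hk
    exact ⟨Sum.inr (j, Quot.mk _ ⟨X', hX'⟩), (Quot.sound ⟨h, hh, heq.symm⟩).symm⟩

theorem orbitMap_bijective : Function.Bijective (orbitMap F n) :=
  ⟨orbitMap_injective, orbitMap_surjective⟩

theorem natCard_quot_eq_one_of_le_one (hn : n ≤ 1) : Nat.card (Quot (AltBCong F n)) = 1 := by
  have := Fin.subsingleton_iff_le_one.2 hn
  refine Nat.card_eq_one_iff_unique.2 ⟨⟨?_⟩, ⟨Quot.mk _ ⟨0, by simp [IsAlternating]⟩⟩⟩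
  rintro ⟨X, hX⟩ ⟨Y, hY⟩
  congr 2
  ext i j
  rw [Subsingleton.elim j i, hX.2, hY.2]

variable (F) in
theorem finite_quot_altBCong : ∀ n : ℕ, Finite (Quot (AltBCong F n))
  | 0 => Nat.finite_of_card_ne_zero (by simp [natCard_quot_eq_one_of_le_one])
  | 1 => Nat.finite_of_card_ne_zero (by simp [natCard_quot_eq_one_of_le_one])
  | n + 2 =>
    have := finite_quot_altBCong n
    have := finite_quot_altBCong (n + 1)
    Finite.of_surjective _ orbitMap_surjective

end Orbits

/-- The number of `B`-congruence orbits of alternating `n × n` matrices is finite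
and satisfies `C 0 = 1`, `C 1 = 1`, `C n = C (n-1) + (n-1) * C (n-2)`. -/
theorem alt_B_congruence_orbit_count (F : Type*) [Field F] :
    (∀ n : ℕ, Finite (Quot (AltBCong F n))) ∧
    Nat.card (Quot (AltBCong F 0)) = 1 ∧
    Nat.card (Quot (AltBCong F 1)) = 1 ∧
    ∀ n : ℕ, 2 ≤ n → Nat.card (Quot (AltBCong F n)) =
      Nat.card (Quot (AltBCong F (n - 1))) +
        (n - 1) * Nat.card (Quot (AltBCong F (n - 2))) := by
  refine ⟨finite_quot_altBCong F, natCard_quot_eq_one_of_le_one zero_le_one,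
    natCard_quot_eq_one_of_le_one le_rfl, fun n hn => ?_⟩
  obtain ⟨m, rfl⟩ := Nat.exists_eq_add_of_le' hn
  have := finite_quot_altBCong F m
  have := finite_quot_altBCong F (m + 1)
  rw [← Nat.card_congr (Equiv.ofBijective _ orbitMap_bijective), Nat.card_sum, Nat.card_prod,
    Nat.card_fin]
  rfl
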